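/- Let G_A(p_A) and G_B(p_B) be frameworks in ℝ^d whose configurations are in general position, whose shared vertex set V_C = V_A ∩ V_B satisfies |V_C| ≥ d + 1 and is a proper subset of both V_A and V_B, and whose configurations agree on V_C. Let Ω_A and Ω_B be positive semidefinite stress matrices of nullity d + 1 for G_A(p_A) and G_B(p_B) respectively. Define the matrix Ω̃ indexed by V = V_A ∪ V_B by Ω̃_{uv} = [if u, v ∈ V_A then (Ω_A)_{uv} else 0] + [if u, v ∈ V_B then (Ω_B)_{uv} else 0]. Then Ω̃ is a positive semidefinite stress matrix of nullity d + 1 for the framework attachment G(p). -/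

import Mathlib

open scoped BigOperators

noncomputable section

/-- A configuration of a framework: an assignment of points in `ℝ^d` to vertices. -/
abbrev Config (V : Type*) (d : ℕ) := V → EuclideanSpace ℝ (Fin d)

/-- The configuration `p`, restricted to the vertex subset `A`, is in general
position. -/
def InGeneralPositionOn {V : Type*} (d : ℕ) (A : Finset V) (p : Config V d) : Prop :=
  ∀ S : Finset V, S ⊆ A → S.card = d + 1 → AffineIndependent ℝ (fun i : S => p i.1)

/-- A stress matrix (indexed by the vertex subset `A`) of the framework with vertex
set `A`, graph `G` (whose edges lie inside `A`) and configuration `p`. -/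
def IsStressMatrixOn {V : Type*} [Fintype V] {d : ℕ} (A : Finset V) (G : SimpleGraph V)
    (p : Config V d) (Ω : Matrix ↥A ↥A ℝ) : Prop :=
  Ω.IsSymm ∧ (∀ i j : ↥A, i ≠ j → ¬ G.Adj i.1 j.1 → Ω i j = 0) ∧
    (∀ i : ↥A, ∑ j : ↥A, Ω i j = 0) ∧ (∀ i : ↥A, ∑ j : ↥A, Ω i j • p j.1 = 0)

/-- A stress matrix (indexed by all vertices) of the framework `G(p)`. -/
def IsStressMatrix {V : Type*} [Fintype V] {d : ℕ} (G : SimpleGraph V) (p : Config V d)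
    (Ω : Matrix V V ℝ) : Prop :=
  Ω.IsSymm ∧ (∀ i j, i ≠ j → ¬ G.Adj i j → Ω i j = 0) ∧
    (∀ i, ∑ j, Ω i j = 0) ∧ (∀ i, ∑ j, Ω i j • p j = 0)

/-- The sum of the two stress matrices after extending each by zeros to the full
vertex set: `Ω̃ u v = [if u, v ∈ A then (Ω_A) u v else 0] + [if u, v ∈ B then (Ω_B) u v
else 0]`. -/
def extendedSum {V : Type*} [DecidableEq V] (A B : Finset V) (ΩA : Matrix ↥A ↥A ℝ)
    (ΩB : Matrix ↥B ↥B ℝ) : Matrix V V ℝ :=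
  Matrix.of fun u v =>
    (if h : u ∈ A ∧ v ∈ A then ΩA ⟨u, h.1⟩ ⟨v, h.2⟩ else 0) +
    (if h : u ∈ B ∧ v ∈ B then ΩB ⟨u, h.1⟩ ⟨v, h.2⟩ else 0)

/-- Extension of a matrix by zeros. -/
def extZ {V : Type*} [DecidableEq V] (A : Finset V) (Ω : Matrix ↥A ↥A ℝ) : Matrix V V ℝ :=
  Matrix.of fun u v => if h : u ∈ A ∧ v ∈ A then Ω ⟨u, h.1⟩ ⟨v, h.2⟩ else 0

lemma extendedSum_eq_add {V : Type*} [DecidableEq V] (A B : Finset V) (ΩA : Matrix ↥A ↥A ℝ)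
    (ΩB : Matrix ↥B ↥B ℝ) : extendedSum A B ΩA ΩB = extZ A ΩA + extZ B ΩB := by
  ext u v; rfl

lemma extZ_sum_smul {V : Type*} [Fintype V] [DecidableEq V] {M : Type*} [AddCommGroup M]
    [Module ℝ M] (A : Finset V) (Ω : Matrix ↥A ↥A ℝ) (f : V → M) (i : V) :
    ∑ j, extZ A Ω i j • f j = if h : i ∈ A then ∑ j : ↥A, Ω ⟨i, h⟩ j • f j.1 else 0 := by
  by_cases hi : i ∈ A
  · rw [dif_pos hi, ← Finset.sum_subset (Finset.subset_univ A), ← Finset.sum_coe_sort]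
    · refine Finset.sum_congr rfl fun j _ => ?_
      simp [extZ, hi]
    · intro j _ hj
      simp [extZ, hj]
  · simp [extZ, hi]

lemma extZ_mulVec {V : Type*} [Fintype V] [DecidableEq V] (A : Finset V)
    (Ω : Matrix ↥A ↥A ℝ) (x : V → ℝ) (i : V) :
    (extZ A Ω).mulVec x i = if h : i ∈ A then Ω.mulVec (fun a => x a.1) ⟨i, h⟩ else 0 :=
  extZ_sum_smul A Ω x i

lemma extZ_eq_mul {V : Type*} [Fintype V] [DecidableEq V] (A : Finset V)
    (Ω : Matrix ↥A ↥A ℝ) :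
    extZ A Ω = Matrix.conjTranspose ((1 : Matrix V V ℝ).submatrix (Subtype.val : ↥A → V) id) * Ω *
      ((1 : Matrix V V ℝ).submatrix (Subtype.val : ↥A → V) id) := by
  have hP : ∀ x : V → ℝ, ((1 : Matrix V V ℝ).submatrix (Subtype.val : ↥A → V) id).mulVec x
      = fun a => x a.1 := by
    intro x
    ext a
    simp [Matrix.mulVec, dotProduct, Matrix.one_apply]
  apply Matrix.ext_of_mulVec_single
  intro v
  ext i
  rw [extZ_mulVec, ← Matrix.mulVec_mulVec, ← Matrix.mulVec_mulVec, hP]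
  generalize Ω.mulVec _ = y
  simp only [Matrix.mulVec, dotProduct, Matrix.conjTranspose_apply, Matrix.submatrix_apply,
    Matrix.one_apply, id, star_trivial, ite_mul, one_mul, zero_mul, apply_ite star, star_one,
    star_zero]
  split_ifs with h
  · rw [Finset.sum_eq_single ⟨i, h⟩]
    · simp
    · intro b _ hb
      rw [if_neg]
      intro e
      exact hb (Subtype.ext e)
    · simp
  · symm
    apply Finset.sum_eq_zero
    intro b _
    rw [if_neg]
    intro e
    exact h (e ▸ b.2)

lemma extZ_posSemidef {V : Type*} [Fintype V] [DecidableEq V] (A : Finset V)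
    (Ω : Matrix ↥A ↥A ℝ) (h : Ω.PosSemidef) : (extZ A Ω).PosSemidef := by
  rw [extZ_eq_mul]
  exact h.conjTranspose_mul_mul_same _

lemma psd_add_ker {V : Type*} [Fintype V] [DecidableEq V] {M N : Matrix V V ℝ}
    (hM : M.PosSemidef) (hN : N.PosSemidef) (x : V → ℝ) (h : (M + N).mulVec x = 0) :
    M.mulVec x = 0 ∧ N.mulVec x = 0 := by
  have h0 : star x ⬝ᵥ M.mulVec x + star x ⬝ᵥ N.mulVec x = 0 := by
    rw [← dotProduct_add, ← Matrix.add_mulVec, h, dotProduct_zero]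
  have h1 := hM.dotProduct_mulVec_nonneg x
  have h2 := hN.dotProduct_mulVec_nonneg x
  exact ⟨(hM.dotProduct_mulVec_zero_iff x).1 (by linarith),
    (hN.dotProduct_mulVec_zero_iff x).1 (by linarith)⟩

/-- Affine functions evaluated along a configuration. -/
def affEval {ι : Type*} {d : ℕ} (q : ι → EuclideanSpace ℝ (Fin d)) :
    (ℝ × EuclideanSpace ℝ (Fin d)) →ₗ[ℝ] (ι → ℝ) where
  toFun t i := t.1 + inner ℝ t.2 (q i)
  map_add' s t := by
    ext i; simp [inner_add_left]; ring
  map_smul' c t := by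
    ext i; simp [inner_smul_left]; ring

lemma affEval_zero_of_affineIndependent {ι : Type*} [Fintype ι] {d : ℕ}
    (q : ι → EuclideanSpace ℝ (Fin d)) (hq : AffineIndependent ℝ q)
    (hc : Fintype.card ι = d + 1) (t : ℝ × EuclideanSpace ℝ (Fin d))
    (ht : affEval q t = 0) : t = 0 := by
  have htop : affineSpan ℝ (Set.range q) = ⊤ := by
    rw [hq.affineSpan_eq_top_iff_card_eq_finrank_add_one, hc]; simp
  have key : ∀ y : EuclideanSpace ℝ (Fin d), t.1 + inner ℝ t.2 y = 0 := by
    intro y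
    have hy : y ∈ affineSpan ℝ (Set.range q) := by rw [htop]; trivial
    refine affineSpan_induction (p := fun y => t.1 + inner ℝ t.2 y = 0) hy ?_ ?_
    · rintro _ ⟨i, rfl⟩
      exact congrFun ht i
    · intro c u v w hu hv hw
      simp only [vsub_eq_sub, vadd_eq_add, inner_add_right, inner_smul_right, inner_sub_right]
      have e : (inner ℝ t.2 u : ℝ) = inner ℝ t.2 v := by linarith
      rw [e]; linarith
  have h0 : t.1 = 0 := by simpa using key 0
  have h1 : t.2 = 0 := by
    have := key t.2
    rw [h0, zero_add] at this
    exact inner_self_eq_zero.1 this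
  exact Prod.ext h0 h1

lemma affEval_mem_ker {ι : Type*} [Fintype ι] {d : ℕ} (q : ι → EuclideanSpace ℝ (Fin d))
    (Ω : Matrix ι ι ℝ) (h1 : ∀ i, ∑ j, Ω i j = 0) (h2 : ∀ i, ∑ j, Ω i j • q j = 0)
    (t : ℝ × EuclideanSpace ℝ (Fin d)) : Ω.mulVec (affEval q t) = 0 := by
  ext i
  have e : ∑ j, Ω i j * (t.1 + inner ℝ t.2 (q j))
      = (∑ j, Ω i j) * t.1 + inner ℝ t.2 (∑ j, Ω i j • q j) := by
    simp [inner_sum, inner_smul_right, mul_add, Finset.sum_add_distrib, Finset.sum_mul]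
  show ∑ j, Ω i j * (t.1 + inner ℝ t.2 (q j)) = 0
  rw [e, h1, h2]; simp

lemma range_affEval_eq_ker {ι : Type*} [Fintype ι] {d : ℕ} (q : ι → EuclideanSpace ℝ (Fin d))
    (Ω : Matrix ι ι ℝ) (h1 : ∀ i, ∑ j, Ω i j = 0) (h2 : ∀ i, ∑ j, Ω i j • q j = 0)
    (hinj : Function.Injective (affEval q))
    (hn : Module.finrank ℝ (LinearMap.ker Ω.mulVecLin) = d + 1) :
    LinearMap.range (affEval q) = LinearMap.ker Ω.mulVecLin := by
  apply Submodule.eq_of_le_of_finrank_eq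
  · rintro _ ⟨t, rfl⟩
    exact affEval_mem_ker q Ω h1 h2 t
  · rw [LinearMap.finrank_range_of_inj hinj, hn]
    simp [add_comm]

/-- Given positive semidefinite stress matrices `Ω_A`, `Ω_B` of nullity `d + 1` for two
frameworks in general position sharing at least `d + 1` vertices, the sum `Ω̃` of their
extensions by zeros is a positive semidefinite stress matrix of nullity `d + 1` for the
framework attachment. -/
theorem extendedSum_psd_stressMatrix_of_attachment
    {V : Type*} [Fintype V] [DecidableEq V] {d : ℕ}
    (A B : Finset V) (GA GB : SimpleGraph V) (p : Config V d)
    (hGA : ∀ i j, GA.Adj i j → i ∈ A ∧ j ∈ A)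
    (hGB : ∀ i j, GB.Adj i j → i ∈ B ∧ j ∈ B)
    (hunion : A ∪ B = Finset.univ)
    (hcard : d + 1 ≤ (A ∩ B).card)
    (hpropA : A ∩ B ⊂ A) (hpropB : A ∩ B ⊂ B)
    (hgenA : InGeneralPositionOn d A p) (hgenB : InGeneralPositionOn d B p)
    (ΩA : Matrix ↥A ↥A ℝ) (ΩB : Matrix ↥B ↥B ℝ)
    (hsA : IsStressMatrixOn A GA p ΩA) (hpsdA : ΩA.PosSemidef)
    (hnA : Module.finrank ℝ (LinearMap.ker ΩA.mulVecLin) = d + 1)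
    (hsB : IsStressMatrixOn B GB p ΩB) (hpsdB : ΩB.PosSemidef)
    (hnB : Module.finrank ℝ (LinearMap.ker ΩB.mulVecLin) = d + 1) :
    IsStressMatrix (GA ⊔ GB) p (extendedSum A B ΩA ΩB) ∧
      (extendedSum A B ΩA ΩB).PosSemidef ∧
      Module.finrank ℝ (LinearMap.ker (extendedSum A B ΩA ΩB).mulVecLin) = d + 1 := by
  obtain ⟨symA, offA, sumA, eqA⟩ := hsA
  obtain ⟨symB, offB, sumB, eqB⟩ := hsB
  obtain ⟨S, hSC, hScard⟩ := Finset.exists_subset_card_eq hcard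
  have hSA : S ⊆ A := fun v hv => (Finset.mem_inter.1 (hSC hv)).1
  have hSB : S ⊆ B := fun v hv => (Finset.mem_inter.1 (hSC hv)).2
  have hS : ∀ t : ℝ × EuclideanSpace ℝ (Fin d),
      (∀ v ∈ S, t.1 + inner ℝ t.2 (p v) = 0) → t = 0 := by
    intro t ht
    refine affEval_zero_of_affineIndependent (fun i : S => p i.1) (hgenA S hSA hScard)
      (by simpa using hScard) t ?_
    ext i
    exact ht i.1 i.2
  have injA : Function.Injective (affEval (fun a : ↥A => p a.1)) := by
    rw [injective_iff_map_eq_zero]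
    exact fun t ht => hS t fun v hv => congrFun ht ⟨v, hSA hv⟩
  have injB : Function.Injective (affEval (fun a : ↥B => p a.1)) := by
    rw [injective_iff_map_eq_zero]
    exact fun t ht => hS t fun v hv => congrFun ht ⟨v, hSB hv⟩
  have injV : Function.Injective (affEval p) := by
    rw [injective_iff_map_eq_zero]
    exact fun t ht => hS t fun v hv => congrFun ht v
  have rA := range_affEval_eq_ker _ ΩA sumA eqA injA hnA
  have rB := range_affEval_eq_ker _ ΩB sumB eqB injB hnB
  have psdA := extZ_posSemidef A ΩA hpsdA
  have psdB := extZ_posSemidef B ΩB hpsdB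
  have hpsd : (extZ A ΩA + extZ B ΩB).PosSemidef := psdA.add psdB
  have hrow : ∀ i, ∑ j, (extZ A ΩA + extZ B ΩB) i j = 0 := by
    intro i
    have a := extZ_sum_smul A ΩA (fun _ => (1 : ℝ)) i
    have b := extZ_sum_smul B ΩB (fun _ => (1 : ℝ)) i
    simp only [smul_eq_mul, mul_one, sumA, sumB, dite_eq_ite, ite_self] at a b
    simp only [Matrix.add_apply, Finset.sum_add_distrib, a, b, add_zero]
  have heq : ∀ i, ∑ j, (extZ A ΩA + extZ B ΩB) i j • p j = 0 := by
    intro i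
    have a := extZ_sum_smul A ΩA p i
    have b := extZ_sum_smul B ΩB p i
    simp only [eqA, eqB, dite_eq_ite, ite_self] at a b
    simp only [Matrix.add_apply, add_smul, Finset.sum_add_distrib, a, b, add_zero]
  rw [extendedSum_eq_add]
  refine ⟨⟨?_, ?_, hrow, heq⟩, hpsd, ?_⟩
  · have := hpsd.isHermitian
    rwa [Matrix.IsHermitian, Matrix.conjTranspose_eq_transpose_of_trivial] at this
  · intro i j hij hadj
    rw [SimpleGraph.sup_adj, not_or] at hadj
    have a : extZ A ΩA i j = 0 := by
      simp only [extZ, Matrix.of_apply]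
      split_ifs with h
      · exact offA _ _ (fun e => hij (congrArg Subtype.val e)) hadj.1
      · rfl
    have b : extZ B ΩB i j = 0 := by
      simp only [extZ, Matrix.of_apply]
      split_ifs with h
      · exact offB _ _ (fun e => hij (congrArg Subtype.val e)) hadj.2
      · rfl
    rw [Matrix.add_apply, a, b, add_zero]
  · have hker : LinearMap.range (affEval p)
        = LinearMap.ker (extZ A ΩA + extZ B ΩB).mulVecLin := by
      apply le_antisymm
      · rintro _ ⟨t, rfl⟩
        exact affEval_mem_ker p _ hrow heq t
      · intro x hx
        obtain ⟨ha, hb⟩ := psd_add_ker psdA psdB x hx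
        have ka : (fun a : ↥A => x a.1) ∈ LinearMap.ker ΩA.mulVecLin := by
          rw [LinearMap.mem_ker]
          ext i
          have := congrFun ha i.1
          rw [extZ_mulVec, dif_pos i.2] at this
          exact this
        have kb : (fun a : ↥B => x a.1) ∈ LinearMap.ker ΩB.mulVecLin := by
          rw [LinearMap.mem_ker]
          ext i
          have := congrFun hb i.1
          rw [extZ_mulVec, dif_pos i.2] at this
          exact this
        rw [← rA] at ka
        rw [← rB] at kb
        obtain ⟨s, hs⟩ := ka
        obtain ⟨t, ht⟩ := kb
        have hs' : ∀ v ∈ A, s.1 + inner ℝ s.2 (p v) = x v := fun v hv => congrFun hs ⟨v, hv⟩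
        have ht' : ∀ v ∈ B, t.1 + inner ℝ t.2 (p v) = x v := fun v hv => congrFun ht ⟨v, hv⟩
        have hst : s - t = 0 := by
          apply hS
          intro v hv
          have e1 := hs' v (hSA hv)
          have e2 := ht' v (hSB hv)
          simp only [Prod.fst_sub, Prod.snd_sub, inner_sub_left]
          linarith
        have hst' : s = t := sub_eq_zero.1 hst
        subst hst'
        refine ⟨s, ?_⟩
        ext v
        have hv : v ∈ A ∪ B := by rw [hunion]; exact Finset.mem_univ v
        rcases Finset.mem_union.1 hv with hv | hv
        · exact hs' v hv
        · exact ht' v hv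
    rw [← hker, LinearMap.finrank_range_of_inj injV]
    simp [add_comm]
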